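/- Let α ∈ (0,1], T > 0, and let f : [0,T] × ℝ → ℝ be continuous, satisfy the Lipschitz condition, and satisfy f(t,0) = 0 for all t ∈ [0,T]. Let x₁, x₂ be solutions on [0,T] of the Caputo fractional initial value problems with initial values x₁₀, x₂₀ satisfying x₁₀ < x₂₀ < 0. Then for all t ∈ [0,T]: x₂₀·E_α(a^*(t) t^α) − x₁₀·E_α(a_*(t) t^α) ≤ x₂(t) − x₁(t) ≤ x₂₀·E_α(a_*(t) t^α) − x₁₀·E_α(a^*(t) t^α), where a_*(t) := inf_{s ∈ [0,t], x ≠ 0} f(s,x)/x and a^*(t) := sup_{s ∈ [0,t], x ≠ 0} f(s,x)/x. -/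

import Mathlib

open Set intervalIntegral

/-- The one-parameter Mittag-Leffler function `E_α(x) = ∑_{k=0}^∞ x^k / Γ(αk+1)`. -/
noncomputable def mittagLeffler (α x : ℝ) : ℝ :=
  ∑' k : ℕ, x ^ k / Real.Gamma (α * (k : ℝ) + 1)

/-- A continuous function `x` on `[0,T]` solves the Caputo fractional initial value
problem `^C D^α_{0+} x(t) = f(t,x(t))`, `x(0) = x₀`, in the equivalent Volterra
integral formulation. -/
def IsCaputoSolution (α T : ℝ) (f : ℝ → ℝ → ℝ) (x₀ : ℝ) (x : ℝ → ℝ) : Prop :=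
  ContinuousOn x (Set.Icc 0 T) ∧
    ∀ t ∈ Set.Icc 0 T,
      x t = x₀ + (1 / Real.Gamma α) * ∫ s in (0:ℝ)..t, (t - s) ^ (α - 1) * f s (x s)

/-- `a_*(t) = inf_{s ∈ [0,t], x ≠ 0} f(s,x)/x`. -/
noncomputable def aLow (f : ℝ → ℝ → ℝ) (t : ℝ) : ℝ :=
  sInf {y | ∃ s ∈ Set.Icc 0 t, ∃ x : ℝ, x ≠ 0 ∧ y = f s x / x}

/-- `a^*(t) = sup_{s ∈ [0,t], x ≠ 0} f(s,x)/x`. -/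
noncomputable def aHigh (f : ℝ → ℝ → ℝ) (t : ℝ) : ℝ :=
  sSup {y | ∃ s ∈ Set.Icc 0 t, ∃ x : ℝ, x ≠ 0 ∧ y = f s x / x}

/-- The Riemann–Liouville fractional integral of order `α` with base point `0`. -/
noncomputable def fracInt (α : ℝ) (g : ℝ → ℝ) (t : ℝ) : ℝ :=
  (1 / Real.Gamma α) * ∫ s in (0:ℝ)..t, (t - s) ^ (α - 1) * g s

theorem integral_sub_rpow_mul_rpow {a b t : ℝ} (ha : 0 < a) (hb : 0 < b) (ht : 0 < t) :
    ∫ s in (0:ℝ)..t, (t - s) ^ (a - 1) * s ^ (b - 1) =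
      Real.Gamma a * Real.Gamma b / Real.Gamma (a + b) * t ^ (a + b - 1) := by
  have h := Complex.betaIntegral_scaled (b : ℂ) (a : ℂ) ht
  have h2 := Complex.betaIntegral_eq_Gamma_mul_div (b : ℂ) (a : ℂ) (by simpa) (by simpa)
  rw [h2] at h
  have h3 : ∫ x in (0:ℝ)..t, (x : ℂ) ^ ((b : ℂ) - 1) * ((t : ℂ) - x) ^ ((a : ℂ) - 1) =
      ∫ x in (0:ℝ)..t, (((t - x) ^ (a - 1) * x ^ (b - 1) : ℝ) : ℂ) := by
    refine integral_congr fun x hx => ?_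
    rw [uIcc_of_le ht.le] at hx
    push_cast
    rw [Complex.ofReal_cpow hx.1, Complex.ofReal_cpow (sub_nonneg.2 hx.2)]
    push_cast
    ring
  rw [h3, intervalIntegral.integral_ofReal] at h
  have h4 : (t : ℂ) ^ ((b : ℂ) + a - 1) = ((t ^ (a + b - 1) : ℝ) : ℂ) := by
    rw [Complex.ofReal_cpow ht.le]
    push_cast
    ring_nf
  rw [h4, ← Complex.ofReal_add, Complex.Gamma_ofReal, Complex.Gamma_ofReal,
    Complex.Gamma_ofReal] at h
  norm_cast at h
  rw [h, add_comm b a]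
  ring

theorem fracInt_rpow {α b t : ℝ} (hα : 0 < α) (hb : 0 ≤ b) (ht : 0 ≤ t) :
    fracInt α (fun s => s ^ b) t =
      Real.Gamma (b + 1) / Real.Gamma (b + α + 1) * t ^ (b + α) := by
  unfold fracInt
  rcases ht.eq_or_lt with rfl | ht
  · simp [Real.zero_rpow (by positivity : b + α ≠ 0)]
  · have h := integral_sub_rpow_mul_rpow hα (by positivity : 0 < b + 1) ht
    simp only [add_sub_cancel_right] at h
    rw [h, show α + (b + 1) = b + α + 1 by ring, add_sub_cancel_right]
    have := (Real.Gamma_pos_of_pos hα).ne'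
    field_simp

theorem intervalIntegrable_sub_rpow_mul {α a b t : ℝ} (hα : 0 < α) {g : ℝ → ℝ}
    (hg : ContinuousOn g (uIcc a b)) :
    IntervalIntegrable (fun s => (t - s) ^ (α - 1) * g s) MeasureTheory.volume a b := by
  refine IntervalIntegrable.mul_continuousOn ?_ hg
  have h := (intervalIntegrable_rpow' (a := t - a) (b := t - b) (r := α - 1)
    (by linarith)).comp_sub_left t
  simpa using h

theorem fracInt_add {α t : ℝ} (hα : 0 < α) (ht : 0 ≤ t) {g h : ℝ → ℝ}
    (hg : ContinuousOn g (Icc 0 t)) (hh : ContinuousOn h (Icc 0 t)) :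
    fracInt α (fun s => g s + h s) t = fracInt α g t + fracInt α h t := by
  rw [← uIcc_of_le ht] at hg hh
  unfold fracInt
  simp only [mul_add]
  rw [integral_add (intervalIntegrable_sub_rpow_mul hα hg)
    (intervalIntegrable_sub_rpow_mul hα hh), mul_add]

theorem fracInt_const_mul (α c t : ℝ) (g : ℝ → ℝ) :
    fracInt α (fun s => c * g s) t = c * fracInt α g t := by
  unfold fracInt
  simp only [mul_left_comm _ c]
  rw [integral_const_mul]
  ring

theorem fracInt_sub {α t : ℝ} (hα : 0 < α) (ht : 0 ≤ t) {g h : ℝ → ℝ}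
    (hg : ContinuousOn g (Icc 0 t)) (hh : ContinuousOn h (Icc 0 t)) :
    fracInt α (fun s => g s - h s) t = fracInt α g t - fracInt α h t := by
  have h1 := fracInt_add hα ht hg (hh.const_mul (-1))
  rw [fracInt_const_mul] at h1
  calc _ = _ := by congr 1; ext s; ring
    _ = _ := h1
    _ = _ := by ring

theorem fracInt_congr {α t : ℝ} (ht : 0 ≤ t) {g h : ℝ → ℝ} (hgh : ∀ s ∈ Icc 0 t, g s = h s) :
    fracInt α g t = fracInt α h t := by
  unfold fracInt
  congr 1
  refine integral_congr fun s hs => ?_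
  rw [uIcc_of_le ht] at hs
  simp only [hgh s hs]

theorem fracInt_mono {α t : ℝ} (hα : 0 < α) (ht : 0 ≤ t) {g h : ℝ → ℝ}
    (hg : ContinuousOn g (Icc 0 t)) (hh : ContinuousOn h (Icc 0 t))
    (hgh : ∀ s ∈ Icc 0 t, g s ≤ h s) : fracInt α g t ≤ fracInt α h t := by
  unfold fracInt
  have := Real.Gamma_pos_of_pos hα
  refine mul_le_mul_of_nonneg_left ?_ (by positivity)
  rw [← uIcc_of_le ht] at hg hh
  refine integral_mono_on ht (intervalIntegrable_sub_rpow_mul hα hg)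
    (intervalIntegrable_sub_rpow_mul hα hh) fun s hs => ?_
  exact mul_le_mul_of_nonneg_left (hgh s hs) (Real.rpow_nonneg (sub_nonneg.2 hs.2) _)

theorem fracInt_const {α t : ℝ} (hα : 0 < α) (ht : 0 ≤ t) (c : ℝ) :
    fracInt α (fun _ => c) t = c * (t ^ α / Real.Gamma (α + 1)) := by
  have h := fracInt_rpow hα le_rfl ht
  simp only [Real.rpow_zero, zero_add, Real.Gamma_one] at h
  have h2 := fracInt_const_mul α c t (fun _ => (1:ℝ))
  simp only [mul_one] at h2
  rw [h2, h]
  ring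

theorem fracInt_sum {ι : Type*} {α t : ℝ} (hα : 0 < α) (ht : 0 ≤ t) (S : Finset ι)
    {g : ι → ℝ → ℝ} (hg : ∀ i ∈ S, ContinuousOn (g i) (Icc 0 t)) :
    fracInt α (fun s => ∑ i ∈ S, g i s) t = ∑ i ∈ S, fracInt α (g i) t := by
  unfold fracInt
  simp only [Finset.mul_sum]
  rw [integral_finsetSum fun i hi => intervalIntegrable_sub_rpow_mul hα
    (by rw [uIcc_of_le ht]; exact hg i hi), Finset.mul_sum]

theorem exp_neg_mul_rpow_le_Gamma {R s : ℝ} (hR : 0 < R) (hs : 0 ≤ s) :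
    Real.exp (-R) * R ^ s ≤ Real.Gamma (s + 1) := by
  rw [Real.Gamma_eq_integral (by linarith), add_sub_cancel_right]
  have hint := Real.GammaIntegral_convergent (by linarith : 0 < s + 1)
  rw [add_sub_cancel_right] at hint
  have hsub : Ioi R ⊆ Ioi (0:ℝ) := Ioi_subset_Ioi hR.le
  calc Real.exp (-R) * R ^ s = ∫ x in Ioi R, Real.exp (-x) * R ^ s := by
        rw [MeasureTheory.integral_mul_const, integral_exp_neg_Ioi]
    _ ≤ ∫ x in Ioi R, Real.exp (-x) * x ^ s := by
        refine MeasureTheory.setIntegral_mono_on ?_ (hint.mono_set hsub) measurableSet_Ioi ?_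
        · exact (integrableOn_exp_neg_Ioi R).mul_const _
        · intro x hx
          have : R < x := hx
          gcongr
    _ ≤ ∫ x in Ioi 0, Real.exp (-x) * x ^ s := by
        refine MeasureTheory.setIntegral_mono_set hint ?_ hsub.eventuallyLE
        filter_upwards [MeasureTheory.ae_restrict_mem measurableSet_Ioi] with x hx
        exact mul_nonneg (Real.exp_pos _).le (Real.rpow_nonneg (le_of_lt hx) _)

theorem summable_pow_div_Gamma {α : ℝ} (hα : 0 < α) (x : ℝ) :
    Summable fun k : ℕ => x ^ k / Real.Gamma (α * (k : ℝ) + 1) := by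
  set b := 2 * |x| + 1 with hb
  have hb0 : 0 < b := by positivity
  set R := b ^ (1 / α) with hRdef
  have hR : 0 < R := by positivity
  refine Summable.of_norm_bounded (g := fun k : ℕ => Real.exp R * (1 / 2) ^ k)
    (summable_geometric_two.mul_left _) fun k => ?_
  have hk : 0 ≤ α * (k : ℝ) := by positivity
  have hΓ : 0 < Real.Gamma (α * (k : ℝ) + 1) := Real.Gamma_pos_of_pos (by linarith)
  have hle := exp_neg_mul_rpow_le_Gamma hR hk
  have hRk : R ^ (α * (k : ℝ)) = b ^ k := by
    rw [Real.rpow_mul hR.le, hRdef, ← Real.rpow_mul hb0.le, one_div_mul_cancel hα.ne',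
      Real.rpow_one, Real.rpow_natCast]
  rw [hRk, Real.exp_neg] at hle
  rw [norm_div, norm_pow, Real.norm_eq_abs, Real.norm_eq_abs, abs_of_pos hΓ, div_le_iff₀ hΓ]
  calc |x| ^ k ≤ (b / 2) ^ k := by gcongr; linarith
    _ = Real.exp R * (1 / 2) ^ k * ((Real.exp R)⁻¹ * b ^ k) := by
        rw [div_pow, one_div, inv_pow]
        field_simp
    _ ≤ _ := by gcongr

theorem continuous_mittagLeffler {α : ℝ} (hα : 0 < α) : Continuous (mittagLeffler α) := by
  refine continuous_iff_continuousAt.2 fun x => ?_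
  have h : ContinuousOn (mittagLeffler α) (Icc (-(|x| + 1)) (|x| + 1)) := by
    refine continuousOn_tsum (u := fun k : ℕ => (|x| + 1) ^ k / Real.Gamma (α * (k : ℝ) + 1))
      (fun k => by fun_prop) (summable_pow_div_Gamma hα _) fun k y hy => ?_
    have hΓ : 0 < Real.Gamma (α * (k : ℝ) + 1) := Real.Gamma_pos_of_pos (by positivity)
    rw [norm_div, norm_pow, Real.norm_eq_abs, Real.norm_eq_abs, abs_of_pos hΓ]
    have := abs_le.2 hy
    gcongr
  exact h.continuousAt (Icc_mem_nhds (by linarith [neg_abs_le x]) (by linarith [le_abs_self x]))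

theorem continuous_mittagLeffler_mul_rpow {α : ℝ} (hα : 0 < α) (a : ℝ) :
    Continuous fun t : ℝ => mittagLeffler α (a * t ^ α) :=
  (continuous_mittagLeffler hα).comp
    (continuous_const.mul (Real.continuous_rpow_const hα.le))

theorem hasSum_mittagLeffler {α : ℝ} (hα : 0 < α) (x : ℝ) :
    HasSum (fun k : ℕ => x ^ k / Real.Gamma (α * (k : ℝ) + 1)) (mittagLeffler α x) :=
  (summable_pow_div_Gamma hα x).hasSum

theorem mittagLeffler_eq_one_add_fracInt {α a t : ℝ} (hα : 0 < α) (ht : 0 ≤ t) :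
    mittagLeffler α (a * t ^ α) =
      1 + fracInt α (fun s => a * mittagLeffler α (a * s ^ α)) t := by
  rw [fracInt_const_mul]
  set F : ℕ → ℝ → ℝ := fun k s =>
    (t - s) ^ (α - 1) * (a ^ k / Real.Gamma (α * (k : ℝ) + 1) * s ^ (α * (k : ℝ))) with hF
  have hΓ : ∀ k : ℕ, 0 < Real.Gamma (α * (k : ℝ) + 1) := fun k =>
    Real.Gamma_pos_of_pos (by positivity)
  have hcont : ∀ k : ℕ, Continuous fun s : ℝ =>
      a ^ k / Real.Gamma (α * (k : ℝ) + 1) * s ^ (α * (k : ℝ)) := fun k =>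
    continuous_const.mul (Real.continuous_rpow_const (by positivity))
  have hexch : HasSum (fun k => ∫ s in (0:ℝ)..t, F k s)
      (∫ s in (0:ℝ)..t, (t - s) ^ (α - 1) * mittagLeffler α (a * s ^ α)) := by
    refine intervalIntegral.hasSum_integral_of_dominated_convergence
      (bound := fun k s =>
        (t - s) ^ (α - 1) * ((|a| * t ^ α) ^ k / Real.Gamma (α * (k : ℝ) + 1))) ?_ ?_ ?_ ?_ ?_
    · intro k
      exact (intervalIntegrable_sub_rpow_mul hα
        (hcont k).continuousOn).def'.aestronglyMeasurable
    · intro k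
      refine Filter.Eventually.of_forall fun s hs => ?_
      rw [uIoc_of_le ht] at hs
      have h0 : 0 ≤ (t - s) ^ (α - 1) := Real.rpow_nonneg (sub_nonneg.2 hs.2) _
      rw [hF, norm_mul, norm_mul, norm_div, norm_pow, Real.norm_of_nonneg h0,
        Real.norm_of_nonneg (hΓ k).le, Real.norm_of_nonneg (Real.rpow_nonneg hs.1.le _),
        Real.norm_eq_abs, mul_pow, ← Real.rpow_natCast (t ^ α), ← Real.rpow_mul ht, mul_div_right_comm]
      have := hΓ k
      gcongr
      · exact hs.1.le
      · exact hs.2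
    · refine Filter.Eventually.of_forall fun s _ => ?_
      exact (summable_pow_div_Gamma hα _).mul_left _
    · simp only [tsum_mul_left]
      exact intervalIntegrable_sub_rpow_mul hα continuousOn_const
    · refine Filter.Eventually.of_forall fun s hs => ?_
      rw [uIoc_of_le ht] at hs
      have h := (hasSum_mittagLeffler hα (a * s ^ α)).mul_left ((t - s) ^ (α - 1))
      refine h.congr_fun fun k => ?_
      rw [mul_pow, ← Real.rpow_natCast (s ^ α), ← Real.rpow_mul hs.1.le]
      ring
  have h2 := (hexch.mul_left (1 / Real.Gamma α)).mul_left a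
  have h3 := (summable_pow_div_Gamma hα (a * t ^ α)).tsum_eq_zero_add
  change mittagLeffler α (a * t ^ α) = _ at h3
  rw [h3]
  simp only [pow_zero, Nat.cast_zero, mul_zero, zero_add, Real.Gamma_one, div_one]
  congr 1
  change _ = a * (1 / Real.Gamma α * _)
  rw [← h2.tsum_eq]
  refine tsum_congr fun k => ?_
  have h4 := fracInt_const_mul α (a ^ k / Real.Gamma (α * (k : ℝ) + 1)) t
    (fun s => s ^ (α * (k : ℝ)))
  rw [fracInt_rpow hα (by positivity) ht] at h4
  change _ = a * (fracInt α _ t)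
  rw [h4, mul_pow, ← Real.rpow_natCast (t ^ α), ← Real.rpow_mul ht]
  push_cast
  rw [mul_add, mul_one]
  have := (hΓ k).ne'
  field_simp
  ring

theorem nonpos_of_forall_le_of_hasDerivAt {J : ℝ → ℝ} {d t : ℝ} (hJ : HasDerivAt J d t)
    (hle : ∀ ε > 0, ∀ᶠ s in nhdsWithin t (Iio t), J t - J s ≤ ε * (t - s)) : d ≤ 0 := by
  refine le_of_forall_pos_le_add fun ε hε => ?_
  rw [zero_add]
  have h := (hasDerivAt_iff_tendsto_slope.1 hJ).mono_left
    (nhdsWithin_mono t (fun s (hs : s ∈ Iio t) => ne_of_lt hs))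
  refine le_of_tendsto h ?_
  filter_upwards [hle ε hε, self_mem_nhdsWithin] with s hs hst
  have hst' : s < t := hst
  rw [slope_comm, slope_def_field, div_le_iff₀ (by linarith)]
  exact hs

theorem fracInt_polynomial {α t : ℝ} (hα : 0 < α) (ht : 0 ≤ t) (P : Polynomial ℝ) :
    fracInt α (fun s => P.eval s) t = ∑ k ∈ Finset.range (P.natDegree + 1),
      P.coeff k * (Real.Gamma (k + 1) / Real.Gamma (k + α + 1)) * t ^ ((k : ℝ) + α) := by
  simp only [Polynomial.eval_eq_sum_range]
  rw [fracInt_sum hα ht _ fun k _ => by fun_prop]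
  refine Finset.sum_congr rfl fun k _ => ?_
  have := fracInt_rpow hα (Nat.cast_nonneg k) ht
  simp only [Real.rpow_natCast] at this
  rw [fracInt_const_mul, this, mul_assoc]

theorem continuous_sum_rpow {α : ℝ} (hα : 0 ≤ α) (c : ℕ → ℝ) (n : ℕ) :
    Continuous fun t : ℝ => ∑ k ∈ Finset.range n, c k * t ^ ((k : ℝ) + α) :=
  continuous_finsetSum _ fun k _ =>
    continuous_const.mul (Real.continuous_rpow_const (by positivity))

theorem differentiableAt_sum_rpow {t : ℝ} (ht : 0 < t) (α : ℝ) (c : ℕ → ℝ) (n : ℕ) :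
    DifferentiableAt ℝ (fun t : ℝ => ∑ k ∈ Finset.range n, c k * t ^ ((k : ℝ) + α)) t := by
  refine DifferentiableAt.fun_sum fun k _ => ?_
  exact (Real.hasDerivAt_rpow_const (Or.inl ht.ne')).differentiableAt.const_mul _

theorem hasDerivAt_fracInt_one_polynomial (t : ℝ) (P : Polynomial ℝ) :
    HasDerivAt (fracInt 1 fun s => P.eval s) (P.eval t) t := by
  have h : fracInt 1 (fun s => P.eval s) = fun t => ∫ s in (0:ℝ)..t, P.eval s := by
    ext t
    simp [fracInt]
  rw [h]
  exact integral_hasDerivAt_right (P.continuous.intervalIntegrable _ _)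
    (P.continuous.stronglyMeasurableAtFilter _ _) P.continuous.continuousAt

theorem fracInt_one_sub_fracInt_polynomial {α t : ℝ} (hα : 0 < α) (hα1 : α < 1) (ht : 0 ≤ t)
    (P : Polynomial ℝ) :
    fracInt (1 - α) (fracInt α fun s => P.eval s) t = fracInt 1 (fun s => P.eval s) t := by
  rw [fracInt_congr ht fun s hs => fracInt_polynomial hα hs.1 P,
    fracInt_sum (by linarith) ht _ fun k _ => ?_, fracInt_polynomial one_pos ht]
  · refine Finset.sum_congr rfl fun k _ => ?_
    rw [fracInt_const_mul, fracInt_rpow (by linarith) (by positivity) ht]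
    have h1 : Real.Gamma ((k : ℝ) + α + 1) ≠ 0 := (Real.Gamma_pos_of_pos (by positivity)).ne'
    rw [show (k : ℝ) + α + (1 - α) = k + 1 by ring]
    field_simp
  · exact (continuous_const.mul (Real.continuous_rpow_const (by positivity))).continuousOn

theorem fracInt_sub_le_of_hasDerivAt {β t : ℝ} (hβ : 0 < β) (hβ1 : β < 1) (ht : 0 < t)
    {u : ℝ → ℝ} (hu : ContinuousOn u (Icc 0 t)) (hu0 : ∀ s ∈ Icc 0 t, 0 ≤ u s) (hut : u t = 0)
    (hd : DifferentiableAt ℝ u t) {ε : ℝ} (hε : 0 < ε) :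
    ∀ᶠ s in nhdsWithin t (Iio t), fracInt β u t - fracInt β u s ≤ ε * (t - s) := by
  have hΓ := Real.Gamma_pos_of_pos hβ
  obtain ⟨C, hC0, hC⟩ := hd.hasDerivAt.isBigO_sub.exists_pos
  have hC := hC.bound
  have hlim : Filter.Tendsto (fun s : ℝ => (t - s) ^ β * C) (nhds t) (nhds 0) := by
    have : ContinuousAt (fun s : ℝ => (t - s) ^ β * C) t :=
      ((Real.continuous_rpow_const hβ.le).comp
        (continuous_const.sub continuous_id)).continuousAt.mul continuousAt_const
    simpa [ContinuousAt, Real.zero_rpow hβ.ne'] using this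
  have hε' : 0 < ε * Real.Gamma β := by positivity
  obtain ⟨l, hl, hsub⟩ := exists_Ioc_subset_of_mem_nhds
    (hC.and (hlim.eventually (gt_mem_nhds hε'))) ⟨t - 1, by linarith⟩
  have hmem : Ioo (max l 0) t ∈ nhdsWithin t (Iio t) :=
    Ioo_mem_nhdsLT (max_lt hl ht)
  filter_upwards [hmem] with r hr
  have hr0 : 0 < r := (le_max_right _ _).trans_lt hr.1
  have hint1 : ContinuousOn u (uIcc 0 r) := by
    rw [uIcc_of_le hr0.le]; exact hu.mono (Icc_subset_Icc_right hr.2.le)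
  have hint2 : ContinuousOn u (uIcc r t) := by
    rw [uIcc_of_le hr.2.le]; exact hu.mono (Icc_subset_Icc_left hr0.le)
  have hi1 := intervalIntegrable_sub_rpow_mul (t := t) hβ hint1
  have hi2 := intervalIntegrable_sub_rpow_mul (t := t) hβ hint2
  have hi3 := intervalIntegrable_sub_rpow_mul (t := r) hβ hint1
  have hsplit := integral_add_adjacent_intervals hi1 hi2
  have hle1 : ∫ s in (0:ℝ)..r, (t - s) ^ (β - 1) * u s ≤
      ∫ s in (0:ℝ)..r, (r - s) ^ (β - 1) * u s := by
    refine integral_mono_on_of_le_Ioo hr0.le hi1 hi3 fun s hs => ?_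
    have h1 : 0 < r - s := by linarith [hs.2]
    refine mul_le_mul_of_nonneg_right ?_ (hu0 s ⟨hs.1.le, by linarith [hs.2, hr.2]⟩)
    exact Real.rpow_le_rpow_of_nonpos h1 (by linarith [hr.2]) (by linarith)
  have hle2 : ∫ s in r..t, (t - s) ^ (β - 1) * u s ≤ ∫ s in r..t, ε * Real.Gamma β := by
    refine integral_mono_on_of_le_Ioo hr.2.le hi2 intervalIntegrable_const fun s hs => ?_
    obtain ⟨h1, h2⟩ := hsub ⟨((le_max_left _ _).trans_lt hr.1).trans hs.1, hs.2.le⟩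
    have hts : 0 < t - s := by linarith [hs.2]
    rw [hut, sub_zero, Real.norm_eq_abs, Real.norm_eq_abs, abs_sub_comm, abs_of_pos hts] at h1
    calc (t - s) ^ (β - 1) * u s ≤ (t - s) ^ (β - 1) * (C * (t - s)) := by
          gcongr
          exact (le_abs_self _).trans h1
      _ = (t - s) ^ β * C := by
          rw [Real.rpow_sub_one hts.ne']
          field_simp
      _ ≤ _ := le_of_lt h2
  rw [integral_const, smul_eq_mul] at hle2
  unfold fracInt
  rw [← mul_sub, one_div, inv_mul_le_iff₀ hΓ]
  calc _ ≤ (t - r) * (ε * Real.Gamma β) := by linarith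
    _ = _ := by ring

theorem polynomial_eval_nonpos_of_fracInt_min {α t : ℝ} (hα : 0 < α) (hα1 : α ≤ 1)
    (ht : 0 < t) (P : Polynomial ℝ)
    (hmin : ∀ s ∈ Icc 0 t,
      fracInt α (fun s => P.eval s) t ≤ fracInt α (fun s => P.eval s) s) :
    P.eval t ≤ 0 := by
  set V := fracInt α fun s => P.eval s with hV
  rcases hα1.eq_or_lt with rfl | hα1
  · refine nonpos_of_forall_le_of_hasDerivAt (hasDerivAt_fracInt_one_polynomial t P) ?_
    intro ε hε
    filter_upwards [Ioo_mem_nhdsLT ht] with s hs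
    have := hmin s ⟨hs.1.le, hs.2.le⟩
    have : 0 < ε * (t - s) := mul_pos hε (by linarith [hs.2])
    linarith
  · have hβ : 0 < 1 - α := by linarith
    set W : ℝ → ℝ := fun t => ∑ k ∈ Finset.range (P.natDegree + 1),
      P.coeff k * (Real.Gamma (k + 1) / Real.Gamma (k + α + 1)) * t ^ ((k : ℝ) + α) with hW
    have hVW : ∀ s, 0 ≤ s → V s = W s := fun s hs => fracInt_polynomial hα hs P
    have hWc : Continuous W := continuous_sum_rpow hα.le _ _
    have hVc : ContinuousOn V (Icc 0 t) := hWc.continuousOn.congr fun s hs => hVW s hs.1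
    have hVd : DifferentiableAt ℝ V t := by
      refine (differentiableAt_sum_rpow ht α _ _ : DifferentiableAt ℝ W t).congr_of_eventuallyEq ?_
      filter_upwards [lt_mem_nhds ht] with s hs using hVW s hs.le
    have hV0 : V t ≤ 0 := by simpa [hV, fracInt] using hmin 0 ⟨le_rfl, ht.le⟩
    have hJ : ∀ s, 0 < s → s ≤ t → fracInt (1 - α) (fun s => V s - V t) s =
        fracInt 1 (fun s => P.eval s) s - V t * (s ^ (1 - α) / Real.Gamma (1 - α + 1)) := by
      intro s hs hst
      rw [fracInt_sub hβ hs.le (hVc.mono (Icc_subset_Icc_right hst)) continuousOn_const,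
        fracInt_const hβ hs.le, hV, fracInt_one_sub_fracInt_polynomial hα hα1 hs.le]
    have hder : HasDerivAt (fun s => fracInt 1 (fun s => P.eval s) s -
        V t * (s ^ (1 - α) / Real.Gamma (1 - α + 1)))
        (P.eval t - V t * ((1 - α) * t ^ (1 - α - 1) / Real.Gamma (1 - α + 1))) t :=
      (hasDerivAt_fracInt_one_polynomial t P).sub
        (((Real.hasDerivAt_rpow_const (Or.inl ht.ne')).div_const _).const_mul _)
    have hnonpos := nonpos_of_forall_le_of_hasDerivAt hder fun ε hε => by
      filter_upwards [fracInt_sub_le_of_hasDerivAt hβ (by linarith) ht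
        (hVc.sub continuousOn_const) (fun s hs => sub_nonneg.2 (hmin s hs)) (sub_self _)
        (hVd.sub_const _) hε, Ioo_mem_nhdsLT ht] with s hs hs2
      rw [← hJ t ht le_rfl, ← hJ s hs2.1 hs2.2.le]
      exact hs
    have hΓ : 0 < Real.Gamma (1 - α + 1) := Real.Gamma_pos_of_pos (by linarith)
    have : 0 ≤ (1 - α) * t ^ (1 - α - 1) / Real.Gamma (1 - α + 1) := by positivity
    nlinarith [mul_nonneg (neg_nonneg.2 hV0) this]

theorem continuousOn_fracInt_polynomial {α T : ℝ} (hα : 0 < α) (P : Polynomial ℝ) :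
    ContinuousOn (fracInt α fun s => P.eval s) (Icc 0 T) :=
  (continuous_sum_rpow hα.le _ _).continuousOn.congr fun _ hs => fracInt_polynomial hα hs.1 P

/-- Weak minimum principle for the Caputo derivative, in Volterra form. -/
theorem add_fracInt_nonneg {α T w₀ : ℝ} (hα : 0 < α) (hα1 : α ≤ 1) {g : ℝ → ℝ}
    (hg : ContinuousOn g (Icc 0 T)) (hw₀ : 0 ≤ w₀)
    (hneg : ∀ s ∈ Icc 0 T, w₀ + fracInt α g s < 0 → 0 ≤ g s) :
    ∀ t ∈ Icc 0 T, 0 ≤ w₀ + fracInt α g t := by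
  intro t ht
  by_contra! hlt
  have hΓ : 0 < Real.Gamma (α + 1) := Real.Gamma_pos_of_pos (by linarith)
  set K := t ^ α / Real.Gamma (α + 1) with hKdef
  have hK : 0 ≤ K := div_nonneg (Real.rpow_nonneg ht.1 _) hΓ.le
  set ε := -(w₀ + fracInt α g t) / (3 * K + 1) with hεdef
  have hε : 0 < ε := div_pos (by linarith) (by positivity)
  have hεK : ε * (3 * K + 1) = -(w₀ + fracInt α g t) := div_mul_cancel₀ _ (by positivity)
  obtain ⟨P, hP⟩ := exists_polynomial_near_of_continuousOn 0 T g hg ε hε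
  set Q := P + Polynomial.C (2 * ε) with hQ
  have hQlow : ∀ s ∈ Icc 0 T, g s + ε ≤ Q.eval s := fun s hs => by
    have := (abs_lt.1 (hP s hs)).1
    simp only [hQ, Polynomial.eval_add, Polynomial.eval_C]
    linarith
  have hQhigh : ∀ s ∈ Icc 0 T, Q.eval s ≤ g s + 3 * ε := fun s hs => by
    have := (abs_lt.1 (hP s hs)).2
    simp only [hQ, Polynomial.eval_add, Polynomial.eval_C]
    linarith
  obtain ⟨r, hr, hmin⟩ := isCompact_Icc.exists_isMinOn ⟨t, ht⟩
    (continuousOn_fracInt_polynomial (T := T) hα Q)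
  have hmin' : ∀ s ∈ Icc 0 T,
      fracInt α (fun s => Q.eval s) r ≤ fracInt α (fun s => Q.eval s) s := fun s hs => hmin hs
  have hr0 : 0 ≤ w₀ + fracInt α (fun s => Q.eval s) r := by
    by_contra! hneg'
    rcases hr.1.eq_or_lt with h0 | hpos
    · rw [← h0] at hneg'
      simp only [fracInt, integral_same, mul_zero, add_zero] at hneg'
      linarith
    · have h1 := polynomial_eval_nonpos_of_fracInt_min hα hα1 hpos Q fun s hs =>
        hmin' s ⟨hs.1, hs.2.trans hr.2⟩
      have h2 : fracInt α g r ≤ fracInt α (fun s => Q.eval s) r :=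
        fracInt_mono hα hr.1 (hg.mono (Icc_subset_Icc_right hr.2)) Q.continuous.continuousOn
          fun s hs => by linarith [hQlow s ⟨hs.1, hs.2.trans hr.2⟩]
      have h3 := hneg r hr (by linarith)
      linarith [hQlow r hr]
  have hgt := hg.mono (Icc_subset_Icc_right ht.2)
  have h4 : fracInt α (fun s => Q.eval s) t ≤ fracInt α (fun s => g s + 3 * ε) t :=
    fracInt_mono hα ht.1 Q.continuous.continuousOn (hgt.add continuousOn_const)
      fun s hs => hQhigh s ⟨hs.1, hs.2.trans ht.2⟩
  rw [fracInt_add hα ht.1 hgt continuousOn_const, fracInt_const hα ht.1, ← hKdef] at h4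
  have := hmin' t ht
  nlinarith

/-- Homogeneous fractional Grönwall inequality. -/
theorem nonpos_of_le_mul_fracInt {α T c : ℝ} (hα : 0 < α) (hc : 0 ≤ c) {φ : ℝ → ℝ}
    (hφ : ContinuousOn φ (Icc 0 T)) (hle : ∀ t ∈ Icc 0 T, φ t ≤ c * fracInt α φ t) :
    ∀ t ∈ Icc 0 T, φ t ≤ 0 := by
  obtain ⟨M, hM⟩ := isCompact_Icc.bddAbove_image hφ
  have key : ∀ n : ℕ, ∀ t ∈ Icc 0 T,
      φ t ≤ M * ((c * t ^ α) ^ n / Real.Gamma (α * (n : ℝ) + 1)) := by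
    intro n
    induction n with
    | zero => intro t ht; simpa using hM (mem_image_of_mem _ ht)
    | succ n ih =>
      intro t ht
      have hΓ : 0 < Real.Gamma (α * (n : ℝ) + 1) := Real.Gamma_pos_of_pos (by positivity)
      have h1 : fracInt α φ t ≤
          fracInt α (fun s => M * c ^ n / Real.Gamma (α * (n : ℝ) + 1) * s ^ (α * (n : ℝ))) t := by
        refine fracInt_mono hα ht.1 (hφ.mono (Icc_subset_Icc_right ht.2))
          (continuous_const.mul (Real.continuous_rpow_const (by positivity))).continuousOn
          fun s hs => (ih s ⟨hs.1, hs.2.trans ht.2⟩).trans_eq ?_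
        rw [mul_pow, ← Real.rpow_natCast (s ^ α), ← Real.rpow_mul hs.1]
        ring
      rw [fracInt_const_mul, fracInt_rpow hα (by positivity) ht.1] at h1
      refine (hle t ht).trans ((mul_le_mul_of_nonneg_left h1 hc).trans_eq ?_)
      rw [mul_pow, ← Real.rpow_natCast (t ^ α), ← Real.rpow_mul ht.1]
      push_cast
      rw [mul_add, mul_one]
      field_simp
      ring
  intro t ht
  have hlim := ((summable_pow_div_Gamma hα (c * t ^ α)).tendsto_atTop_zero).const_mul M
  rw [mul_zero] at hlim
  exact ge_of_tendsto' hlim fun n => key n t ht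

theorem nonneg_of_eq_add_fracInt {α T w₀ c : ℝ} (hα : 0 < α) (hα1 : α ≤ 1) (hc : 0 ≤ c)
    {g w : ℝ → ℝ} (hg : ContinuousOn g (Icc 0 T)) (hw : ContinuousOn w (Icc 0 T))
    (hw₀ : 0 ≤ w₀) (heq : ∀ t ∈ Icc 0 T, w t = w₀ + fracInt α g t)
    (hneg : ∀ s ∈ Icc 0 T, w s < 0 → c * w s ≤ g s) :
    ∀ t ∈ Icc 0 T, 0 ≤ w t := by
  set φ : ℝ → ℝ := fun s => max (-w s) 0 with hφ
  have hφc : ContinuousOn φ (Icc 0 T) := hw.neg.sup continuousOn_const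
  have hφ0 : ∀ s, 0 ≤ φ s := fun s => le_max_right _ _
  have hcφ : ContinuousOn (fun s => c * φ s) (Icc 0 T) := hφc.const_mul c
  have hsplit : ∀ t ∈ Icc 0 T,
      fracInt α (fun s => g s + c * φ s) t = fracInt α g t + c * fracInt α φ t := fun t ht => by
    rw [fracInt_add hα ht.1 (hg.mono (Icc_subset_Icc_right ht.2))
      (hcφ.mono (Icc_subset_Icc_right ht.2)), fracInt_const_mul]
  have hI : ∀ t ∈ Icc 0 T, 0 ≤ fracInt α φ t := fun t ht => by
    have := fracInt_mono hα ht.1 (continuousOn_const (c := (0:ℝ)))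
      (hφc.mono (Icc_subset_Icc_right ht.2)) fun s _ => hφ0 s
    rwa [fracInt_const hα ht.1, zero_mul] at this
  have hz := add_fracInt_nonneg (g := fun s => g s + c * φ s) hα hα1 (hg.add hcφ) hw₀ fun s hs hlt => by
    rw [hsplit s hs] at hlt
    have h1 : w s < 0 := by
      rw [heq s hs]
      linarith [mul_nonneg hc (hI s hs)]
    have h2 : φ s = -w s := max_eq_left (by linarith)
    have h3 := hneg s hs h1
    simp only [h2]
    linarith
  have hφle := nonpos_of_le_mul_fracInt hα hc hφc fun t ht => by
    refine max_le ?_ (mul_nonneg hc (hI t ht))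
    have := hz t ht
    rw [hsplit t ht] at this
    linarith [heq t ht]
  intro t ht
  linarith [hφle t ht, le_max_left (-w t) 0]

/-- A Volterra solution with nonnegative initial value whose right-hand side is squeezed between
two linear ones is squeezed between the corresponding Mittag-Leffler functions. -/
theorem mittagLeffler_bounds_of_linear_bounds {α T u₀ c a b : ℝ} (hα : 0 < α) (hα1 : α ≤ 1)
    (hc : 0 ≤ c) {g u : ℝ → ℝ} (hg : ContinuousOn g (Icc 0 T)) (hu : ContinuousOn u (Icc 0 T))
    (hu₀ : 0 ≤ u₀) (heq : ∀ t ∈ Icc 0 T, u t = u₀ + fracInt α g t)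
    (hneg : ∀ s ∈ Icc 0 T, u s < 0 → c * u s ≤ g s)
    (hpos : ∀ s ∈ Icc 0 T, 0 ≤ u s → a * u s ≤ g s ∧ g s ≤ b * u s) :
    ∀ t ∈ Icc 0 T, u₀ * mittagLeffler α (a * t ^ α) ≤ u t ∧
      u t ≤ u₀ * mittagLeffler α (b * t ^ α) := by
  have hu0 := nonneg_of_eq_add_fracInt hα hα1 hc hg hu hu₀ heq hneg
  have hyc : ∀ d : ℝ, ContinuousOn (fun t => u₀ * mittagLeffler α (d * t ^ α)) (Icc 0 T) :=
    fun d => (continuous_const.mul (continuous_mittagLeffler_mul_rpow hα d)).continuousOn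
  have hdyc : ∀ d : ℝ, ContinuousOn (fun t => d * (u₀ * mittagLeffler α (d * t ^ α))) (Icc 0 T) :=
    fun d => (hyc d).const_mul d
  have hy : ∀ d : ℝ, ∀ t ∈ Icc 0 T, u₀ * mittagLeffler α (d * t ^ α) =
      u₀ + fracInt α (fun s => d * (u₀ * mittagLeffler α (d * s ^ α))) t := fun d t ht => by
    simp only [mul_left_comm d u₀]
    rw [fracInt_const_mul, mittagLeffler_eq_one_add_fracInt hα ht.1]
    ring
  intro t ht
  constructor
  · have := nonneg_of_eq_add_fracInt (w := fun t => u t - u₀ * mittagLeffler α (a * t ^ α))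
      (g := fun s => g s - a * (u₀ * mittagLeffler α (a * s ^ α)))
      hα hα1 (abs_nonneg a) (hg.sub (hdyc a)) (hu.sub (hyc a)) le_rfl
      (fun s hs => by
        have hsub : Icc 0 s ⊆ Icc 0 T := Icc_subset_Icc_right hs.2
        rw [fracInt_sub hα hs.1 (hg.mono hsub) ((hdyc a).mono hsub), heq s hs, hy a s hs]
        ring)
      (fun s hs hlt => by
        have h1 := (hpos s hs (hu0 s hs)).1
        have h2 := mul_le_mul_of_nonpos_right (le_abs_self a) hlt.le
        linarith) t ht
    linarith
  · have := nonneg_of_eq_add_fracInt (w := fun t => u₀ * mittagLeffler α (b * t ^ α) - u t)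
      (g := fun s => b * (u₀ * mittagLeffler α (b * s ^ α)) - g s)
      hα hα1 (abs_nonneg b) ((hdyc b).sub hg) ((hyc b).sub hu) le_rfl
      (fun s hs => by
        have hsub : Icc 0 s ⊆ Icc 0 T := Icc_subset_Icc_right hs.2
        rw [fracInt_sub hα hs.1 ((hdyc b).mono hsub) (hg.mono hsub), heq s hs, hy b s hs]
        ring)
      (fun s hs hlt => by
        have h1 := (hpos s hs (hu0 s hs)).2
        have h2 := mul_le_mul_of_nonpos_right (le_abs_self b) hlt.le
        linarith) t ht
    linarith

theorem exists_forall_abs_le_mul_abs {T t : ℝ} {f : ℝ → ℝ → ℝ} {L : ℝ → ℝ}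
    (hLc : ContinuousOn L (Icc 0 T))
    (hLip : ∀ t ∈ Icc 0 T, ∀ x y : ℝ, |f t x - f t y| ≤ L t * |x - y|)
    (hf0 : ∀ t ∈ Icc 0 T, f t 0 = 0) (ht : t ≤ T) :
    ∃ c, 0 ≤ c ∧ ∀ s ∈ Icc 0 t, ∀ x : ℝ, |f s x| ≤ c * |x| := by
  obtain ⟨c, hc⟩ := isCompact_Icc.bddAbove_image hLc
  refine ⟨max c 0, le_max_right _ _, fun s hs x => ?_⟩
  have hs' : s ∈ Icc 0 T := ⟨hs.1, hs.2.trans ht⟩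
  have h := hLip s hs' x 0
  rw [hf0 s hs', sub_zero, sub_zero] at h
  refine h.trans (mul_le_mul_of_nonneg_right ?_ (abs_nonneg x))
  exact (hc (mem_image_of_mem _ hs')).trans (le_max_left _ _)

theorem aLow_le_div_and_div_le_aHigh {t c : ℝ} {f : ℝ → ℝ → ℝ}
    (hc : ∀ s ∈ Icc 0 t, ∀ x : ℝ, |f s x| ≤ c * |x|) {s : ℝ} (hs : s ∈ Icc 0 t)
    {x : ℝ} (hx : x ≠ 0) : aLow f t ≤ f s x / x ∧ f s x / x ≤ aHigh f t := by
  have hbound : ∀ y ∈ {y | ∃ s ∈ Icc 0 t, ∃ x : ℝ, x ≠ 0 ∧ y = f s x / x}, |y| ≤ c := by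
    rintro y ⟨s, hs, x, hx, rfl⟩
    rw [abs_div, div_le_iff₀ (abs_pos.2 hx)]
    exact hc s hs x
  exact ⟨csInf_le ⟨-c, fun y hy => (abs_le.1 (hbound y hy)).1⟩ ⟨s, hs, x, hx, rfl⟩,
    le_csSup ⟨c, fun y hy => (abs_le.1 (hbound y hy)).2⟩ ⟨s, hs, x, hx, rfl⟩⟩

/-- Two-sided Mittag-Leffler bounds for a solution with nonpositive initial value. -/
theorem IsCaputoSolution.mittagLeffler_bounds_of_nonpos {α T : ℝ} (hα : 0 < α) (hα1 : α ≤ 1)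
    {f : ℝ → ℝ → ℝ}
    (hf : ContinuousOn (fun p : ℝ × ℝ => f p.1 p.2) (Icc 0 T ×ˢ univ))
    {L : ℝ → ℝ} (hLc : ContinuousOn L (Icc 0 T))
    (hLip : ∀ t ∈ Icc 0 T, ∀ x y : ℝ, |f t x - f t y| ≤ L t * |x - y|)
    (hf0 : ∀ t ∈ Icc 0 T, f t 0 = 0) {x₀ : ℝ} (hx₀ : x₀ ≤ 0) {x : ℝ → ℝ}
    (hx : IsCaputoSolution α T f x₀ x) {t : ℝ} (ht : t ∈ Icc 0 T) :
    x₀ * mittagLeffler α (aHigh f t * t ^ α) ≤ x t ∧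
      x t ≤ x₀ * mittagLeffler α (aLow f t * t ^ α) := by
  obtain ⟨c, hc0, hc⟩ := exists_forall_abs_le_mul_abs hLc hLip hf0 ht.2
  have hsub : Icc 0 t ⊆ Icc 0 T := Icc_subset_Icc_right ht.2
  have hxc : ContinuousOn x (Icc 0 t) := hx.1.mono hsub
  have hgc : ContinuousOn (fun s => f s (x s)) (Icc 0 t) :=
    hf.comp (continuousOn_id.prodMk hxc) fun s hs => ⟨hsub hs, mem_univ _⟩
  have h := mittagLeffler_bounds_of_linear_bounds (T := t) (u₀ := -x₀) (c := c)
    (a := aLow f t) (b := aHigh f t) (g := fun s => (-1) * f s (x s)) (u := fun s => -x s)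
    hα hα1 hc0 (hgc.const_mul (-1)) hxc.neg (by linarith)
    (fun s hs => by
      rw [fracInt_const_mul, hx.2 s (hsub hs), fracInt]
      ring)
    (fun s hs hlt => by
      have h1 := hc s hs (x s)
      rw [abs_of_pos (by linarith : 0 < x s)] at h1
      linarith [le_abs_self (f s (x s))])
    (fun s hs hle => by
      rcases eq_or_ne (x s) 0 with h0 | h0
      · simp [h0, hf0 s (hsub hs)]
      · obtain ⟨h1, h2⟩ := aLow_le_div_and_div_le_aHigh hc hs h0
        have h3 : f s (x s) = f s (x s) / x s * x s := (div_mul_cancel₀ _ h0).symm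
        have h4 := mul_le_mul_of_nonneg_right h1 hle
        have h5 := mul_le_mul_of_nonneg_right h2 hle
        constructor <;> linarith)
    t ⟨ht.1, le_rfl⟩
  constructor <;> linarith [h.1, h.2]

/-- Separation bounds for two solutions with `x₁₀ < x₂₀ < 0`. -/
theorem caputo_separation_neg_neg (α T : ℝ) (hα : 0 < α) (hα1 : α ≤ 1) (hT : 0 < T)
    (f : ℝ → ℝ → ℝ)
    (hf : ContinuousOn (fun p : ℝ × ℝ => f p.1 p.2) (Set.Icc 0 T ×ˢ Set.univ))
    (L : ℝ → ℝ) (hLc : ContinuousOn L (Set.Icc 0 T))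
    (hLnn : ∀ t ∈ Set.Icc 0 T, 0 ≤ L t)
    (hLip : ∀ t ∈ Set.Icc 0 T, ∀ x y : ℝ, |f t x - f t y| ≤ L t * |x - y|)
    (hf0 : ∀ t ∈ Set.Icc 0 T, f t 0 = 0)
    (x₁₀ x₂₀ : ℝ) (h₁ : x₁₀ < x₂₀) (h₂ : x₂₀ < 0) (x₁ x₂ : ℝ → ℝ)
    (hx₁ : IsCaputoSolution α T f x₁₀ x₁) (hx₂ : IsCaputoSolution α T f x₂₀ x₂) :
    ∀ t ∈ Set.Icc 0 T,
      x₂₀ * mittagLeffler α (aHigh f t * t ^ α)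
          - x₁₀ * mittagLeffler α (aLow f t * t ^ α) ≤ x₂ t - x₁ t ∧
        x₂ t - x₁ t ≤ x₂₀ * mittagLeffler α (aLow f t * t ^ α)
          - x₁₀ * mittagLeffler α (aHigh f t * t ^ α) := by
  intro t ht
  have b₁ := hx₁.mittagLeffler_bounds_of_nonpos hα hα1 hf hLc hLip hf0 (h₁.trans h₂).le ht
  have b₂ := hx₂.mittagLeffler_bounds_of_nonpos hα hα1 hf hLc hLip hf0 h₂.le ht
  constructor <;> linarith [b₁.1, b₁.2, b₂.1, b₂.2]
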